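/- arXiv:2603.04326 — 6 statements merged into one kernel-verified Lean document; each statement's English description precedes it below -/
import Mathlib

section
/- For every matrix M ∈ M₂(ℂ) one has the basic Fierz/completeness identity M = -(1/2)·Σ_{μ=0}^{3} e^μ · adj(M) · e_μ, and likewise M = -(1/2)·Σ_{μ=0}^{3} e_μ · adj(M) · e^μ. -/
open Matrix

noncomputable section

/-- The space algebra `Cl(3)` represented as `M₂(ℂ)`. -/
abbrev M2 : Type := Matrix (Fin 2) (Fin 2) ℂ

/-- Basis paravectors: `e 0 = 1` and the Pauli matrices. -/
def e : Fin 4 → M2 :=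
  ![1, !![0, 1; 1, 0], !![0, -Complex.I; Complex.I, 0], !![1, 0; 0, -1]]

/-- Dual basis paravectors: `edual 0 = 1` and `edual k = - e k` for `k = 1,2,3`. -/
def edual : Fin 4 → M2 :=
  ![1, -e 1, -e 2, -e 3]

/-- Basic Fierz/completeness identity. -/
theorem fierz_identity (M : M2) :
    M = (-(1/2) : ℂ) • ∑ μ : Fin 4, edual μ * M.adjugate * e μ ∧
    M = (-(1/2) : ℂ) • ∑ μ : Fin 4, e μ * M.adjugate * edual μ := by
  have hI : ∀ z : ℂ, Complex.I * z * Complex.I = -z := fun z => by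
    linear_combination z * Complex.I_mul_I
  constructor <;>
  · ext i j
    fin_cases i <;> fin_cases j <;>
    simp [Fin.sum_univ_four, e, edual, Matrix.adjugate_fin_two, Matrix.mul_apply,
      Fin.sum_univ_two, hI] <;> ring
end
end

section
/- Let P := ½(1+e₃) = !![1,0;0,0] and P̄ := adj(P) = !![0,0;0,1]. For every φ ∈ M₂(ℂ) and every μ ∈ {0,1,2,3}: ½·tr( P·adj(φ)·e^μ·φ̂·P ) = (φ̂·P·adj(φ))_μ = (φ·P̄·φ†)^μ. -/
open Matrix

noncomputable section

/-- The grade automorphism `M̂ = (adj M)†`. -/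
def gradeAut (M : M2) : M2 := (M.adjugate)ᴴ

/-- Contravariant coefficients: `M^μ = ½ tr (M * e μ)` (note `e 0 = 1`). -/
def contraCoeff (M : M2) (μ : Fin 4) : ℂ := (1/2) * (M * e μ).trace

/-- Covariant coefficients: `M_0 = M^0` and `M_k = -M^k` for `k = 1,2,3`. -/
def covCoeff (M : M2) (μ : Fin 4) : ℂ :=
  if μ = 0 then contraCoeff M 0 else -contraCoeff M μ

/-- The projector `P = ½(1+e₃)`. -/
def P : M2 := !![1, 0; 0, 0]

/-- The projector `P̄ = ½(1-e₃)`. -/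
def Pbar : M2 := !![0, 0; 0, 1]

theorem chiral_coeff_identity (φ : M2) (μ : Fin 4) :
    (1/2 : ℂ) * (P * φ.adjugate * edual μ * gradeAut φ * P).trace
      = covCoeff (gradeAut φ * P * φ.adjugate) μ ∧
    covCoeff (gradeAut φ * P * φ.adjugate) μ = contraCoeff (φ * Pbar * φᴴ) μ := by
  obtain ⟨a, b, c, d, rfl⟩ : ∃ a b c d, φ = !![a, b; c, d] :=
    ⟨_, _, _, _, Matrix.eta_fin_two φ⟩
  have hc : ∀ x y z w : ℂ, (!![x, y; z, w] : M2)ᴴ = !![star x, star z; star y, star w] := by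
    intro x y z w
    ext i j
    fin_cases i <;> fin_cases j <;> rfl
  fin_cases μ <;> constructor <;>
    simp [covCoeff, contraCoeff, gradeAut, hc, edual, e, P, Pbar, Matrix.adjugate_fin_two_of,
      Matrix.trace_fin_two, Matrix.mul_apply, Fin.sum_univ_two, Matrix.conjTranspose_apply] <;>
    ring
end
end

section
/- Conservation of the chiral current: under the right-spinor Dirac setup, the components of the chiral current satisfy Σ_{μ=0}^{3} ∂_μ j^μ = 0 on ℝ⁴, i.e. ∂₀j⁰ + ∂₁j¹ + ∂₂j² + ∂₃j³ = 0. -/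
open Matrix

noncomputable section

/-- Spacetime `ℝ⁴`. -/
abbrev R4 : Type := Fin 4 → ℝ

/-- Partial derivative `∂_μ` of a complex-valued function on `ℝ⁴`. -/
def pdC (μ : Fin 4) (f : R4 → ℂ) (x : R4) : ℂ := fderiv ℝ f x (Pi.single μ 1)

/-- Partial derivative `∂_μ` of a real-valued function on `ℝ⁴`. -/
def pdR (μ : Fin 4) (f : R4 → ℝ) (x : R4) : ℝ := fderiv ℝ f x (Pi.single μ 1)

/-- Entrywise partial derivative `∂_μ` of an `M₂(ℂ)`-valued function on `ℝ⁴`. -/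
def pdM (μ : Fin 4) (f : R4 → M2) (x : R4) : M2 :=
  Matrix.of fun i j => pdC μ (fun y => f y i j) x

/-- Components of the chiral current `𝔧 = φ·P̄·φ†`: `j^μ = ½ tr(𝔧 * e μ)`
(note `e 0 = 1`). -/
def jComp (φ : R4 → M2) (μ : Fin 4) (x : R4) : ℂ :=
  (1/2) * (φ x * Pbar * (φ x)ᴴ * e μ).trace

/-- Tétrode's energy-momentum tensor `T_ν^μ`. -/
def TComp (Γ : Fin 4 → R4 → ℝ) (φ : R4 → M2) (ν μ : Fin 4) (x : R4) : ℂ :=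
  -(Complex.I / 4) *
      (edual μ *
        (pdM ν (fun y => gradeAut (φ y)) x * P * (φ x).adjugate
          - gradeAut (φ x) * P * pdM ν (fun y => (φ y).adjugate) x)).trace
    + (Γ ν x : ℂ) * jComp φ μ x

/-- The Levi-Civita symbol on `{1,2,3}` (indexed by `Fin 3`), with `ε 0 1 2 = 1`. -/
def eps : Fin 3 → Fin 3 → Fin 3 → ℝ := fun i j k =>
  if (i, j, k) = (0, 1, 2) ∨ (i, j, k) = (1, 2, 0) ∨ (i, j, k) = (2, 0, 1) then 1
  else if (i, j, k) = (2, 1, 0) ∨ (i, j, k) = (1, 0, 2) ∨ (i, j, k) = (0, 2, 1) then -1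
  else 0

theorem pdC_star (μ : Fin 4) (f : R4 → ℂ) (x : R4) :
    pdC μ (fun y => star (f y)) x = star (pdC μ f x) := by
  unfold pdC
  rw [fderiv_star]
  rfl

theorem pdC_neg (μ : Fin 4) (f : R4 → ℂ) (x : R4) :
    pdC μ (fun y => -(f y)) x = -(pdC μ f x) := by
  unfold pdC
  rw [fderiv_fun_neg]
  rfl

theorem pdC_const0 (μ : Fin 4) (x : R4) : pdC μ (fun _ => 0) x = 0 := by
  simp [pdC]

theorem pdC_add (μ : Fin 4) (f g : R4 → ℂ) (x : R4) (hf : DifferentiableAt ℝ f x)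
    (hg : DifferentiableAt ℝ g x) :
    pdC μ (fun y => f y + g y) x = pdC μ f x + pdC μ g x := by
  unfold pdC
  rw [fderiv_fun_add hf hg]
  rfl

theorem pdC_mul (μ : Fin 4) (f g : R4 → ℂ) (x : R4) (hf : DifferentiableAt ℝ f x)
    (hg : DifferentiableAt ℝ g x) :
    pdC μ (fun y => f y * g y) x = f x * pdC μ g x + pdC μ f x * g x := by
  unfold pdC
  rw [fderiv_fun_mul hf hg]
  simp [mul_comm]

theorem pdC_cmul (μ : Fin 4) (c : ℂ) (f : R4 → ℂ) (x : R4) (hf : DifferentiableAt ℝ f x) :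
    pdC μ (fun y => c * f y) x = c * pdC μ f x := by
  rw [pdC_mul _ _ _ _ (differentiableAt_const c) hf]
  simp [pdC]

theorem pdC_quad (μ : Fin 4) (c1 c2 : ℂ) (a b c d : R4 → ℂ) (x : R4)
    (ha : DifferentiableAt ℝ a x) (hb : DifferentiableAt ℝ b x)
    (hc : DifferentiableAt ℝ c x) (hd : DifferentiableAt ℝ d x) :
    pdC μ (fun y => c1 * (a y * star (b y)) + c2 * (c y * star (d y))) x =
      c1 * (a x * star (pdC μ b x) + pdC μ a x * star (b x)) +
      c2 * (c x * star (pdC μ d x) + pdC μ c x * star (d x)) := by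
  have hb' := hb.star
  have hd' := hd.star
  rw [pdC_add _ _ _ _ ((ha.fun_mul hb').const_mul c1) ((hc.fun_mul hd').const_mul c2),
    pdC_cmul _ _ _ _ (ha.fun_mul hb'), pdC_cmul _ _ _ _ (hc.fun_mul hd'),
    pdC_mul _ _ _ _ ha hb', pdC_mul _ _ _ _ hc hd', pdC_star, pdC_star]

/-- Conservation of the chiral current for the right-spinor Dirac equation. -/
theorem chiral_current_conservation
    (Γ : Fin 4 → R4 → ℝ) (hΓ : ∀ μ, ContDiff ℝ (⊤ : ℕ∞) (Γ μ))
    (φ : R4 → M2) (hφ : ∀ i j, ContDiff ℝ (⊤ : ℕ∞) (fun x => φ x i j))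
    (hDirac : ∀ x : R4,
      (∑ μ : Fin 4, edual μ * pdM μ (fun y => gradeAut (φ y) * P) x)
        + Complex.I • ((∑ μ : Fin 4, (Γ μ x : ℂ) • edual μ) * (gradeAut (φ x) * P)) = 0) :
    ∀ x : R4, ∑ μ : Fin 4, pdC μ (fun y => jComp φ μ y) x = 0 := by
  intro x
  have hd : ∀ i j, DifferentiableAt ℝ (fun y => φ y i j) x := fun i j =>
    ((hφ i j).differentiable (by simp)).differentiableAt
  have j0 : (fun y => jComp φ 0 y) = fun y =>
      (1/2 : ℂ) * (φ y 0 1 * star (φ y 0 1)) + (1/2 : ℂ) * (φ y 1 1 * star (φ y 1 1)) := by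
    funext y
    simp [jComp, e, Pbar, Matrix.trace_fin_two, Matrix.mul_apply, Fin.sum_univ_two]
    try ring
  have j1 : (fun y => jComp φ 1 y) = fun y =>
      (1/2 : ℂ) * (φ y 0 1 * star (φ y 1 1)) + (1/2 : ℂ) * (φ y 1 1 * star (φ y 0 1)) := by
    funext y
    simp [jComp, e, Pbar, Matrix.trace_fin_two, Matrix.mul_apply, Fin.sum_univ_two]
    try ring
  have j2 : (fun y => jComp φ 2 y) = fun y =>
      (Complex.I/2 : ℂ) * (φ y 0 1 * star (φ y 1 1))
        + (-Complex.I/2 : ℂ) * (φ y 1 1 * star (φ y 0 1)) := by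
    funext y
    simp [jComp, e, Pbar, Matrix.trace_fin_two, Matrix.mul_apply, Fin.sum_univ_two]
    try ring
  have j3 : (fun y => jComp φ 3 y) = fun y =>
      (1/2 : ℂ) * (φ y 0 1 * star (φ y 0 1)) + (-1/2 : ℂ) * (φ y 1 1 * star (φ y 1 1)) := by
    funext y
    simp [jComp, e, Pbar, Matrix.trace_fin_two, Matrix.mul_apply, Fin.sum_univ_two]
    try ring
  have hG : ∀ y, gradeAut (φ y) * P = !![star (φ y 1 1), 0; -star (φ y 0 1), 0] := by
    intro y
    ext i j
    fin_cases i <;> fin_cases j <;>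
      simp [gradeAut, P, Matrix.adjugate_fin_two, Matrix.mul_apply, Fin.sum_univ_two]
  have hD : ∀ μ, pdM μ (fun y => gradeAut (φ y) * P) x =
      !![star (pdC μ (fun y => φ y 1 1) x), 0; -star (pdC μ (fun y => φ y 0 1) x), 0] := by
    intro μ
    simp only [hG]
    ext i j
    fin_cases i <;> fin_cases j <;> simp [pdM, pdC_const0]
    · exact pdC_star μ _ x
    · rw [← Complex.star_def, ← pdC_star, ← pdC_neg]
  have H := hDirac x
  simp only [hD] at H
  rw [hG] at H
  have H0 := congrFun (congrFun H 0) 0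
  have H1 := congrFun (congrFun H 1) 0
  simp [Fin.sum_univ_four, edual, e, Matrix.mul_apply, Fin.sum_univ_two] at H0 H1
  have H0' := congrArg star H0
  have H1' := congrArg star H1
  simp at H0' H1'
  rw [Fin.sum_univ_four, j0, j1, j2, j3]
  rw [pdC_quad _ _ _ _ _ _ _ _ (hd _ _) (hd _ _) (hd _ _) (hd _ _),
    pdC_quad _ _ _ _ _ _ _ _ (hd _ _) (hd _ _) (hd _ _) (hd _ _),
    pdC_quad _ _ _ _ _ _ _ _ (hd _ _) (hd _ _) (hd _ _) (hd _ _),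
    pdC_quad _ _ _ _ _ _ _ _ (hd _ _) (hd _ _) (hd _ _) (hd _ _)]
  simp only [Complex.star_def]
  linear_combination (1/2) * φ x 1 1 * H0 + (1/2) * (starRingEnd ℂ) (φ x 1 1) * H0'
    - (1/2) * φ x 0 1 * H1 - (1/2) * (starRingEnd ℂ) (φ x 0 1) * H1'
end
end

section
/- Quantization condition: under the right-spinor Dirac setup with j⁰ nonvanishing on ℝ⁴, set ρ := j⁰, v^k := j^k/j⁰ (k = 1,2,3), p_n := T_n^0 and u_n := p_n/ρ (n = 1,2,3). Then for each i ∈ {1,2,3} and everywhere on ℝ⁴: Σ_{m,n=1}^{3} ε_{imn}·( ∂_m(u_n - Γ_n) + (1/4)·Σ_{k=1}^{3} v^k·[(∂_m v⃗) × (∂_n v⃗)]^k ) = 0, where v⃗ := (v¹,v²,v³), the cross product is (a⃗ × b⃗)^i := Σ_{j,k} ε_{ijk} a^j b^k, and ε is the standard Levi-Civita symbol with ε₁₂₃ = 1. -/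
open Matrix

noncomputable section

/-- Real components of the chiral current. -/
def jR (φ : R4 → M2) (μ : Fin 4) (x : R4) : ℝ := (jComp φ μ x).re

/-- Real components of the energy-momentum tensor. -/
def TR (Γ : Fin 4 → R4 → ℝ) (φ : R4 → M2) (ν μ : Fin 4) (x : R4) : ℝ :=
  (TComp Γ φ ν μ x).re

/-- The velocity `v^k = j^k / j⁰`. -/
def vR (φ : R4 → M2) (k : Fin 3) (x : R4) : ℝ := jR φ k.succ x / jR φ 0 x

/-- Cross product of two vectors in `ℝ³`, `(a × b)^i = Σ_{j,k} ε_{ijk} a^j b^k`. -/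
def cross3 (a b : Fin 3 → ℝ) (i : Fin 3) : ℝ :=
  ∑ j : Fin 3, ∑ k : Fin 3, eps i j k * a j * b k

lemma pdR_add' {f g : R4 → ℝ} (m : Fin 4) (x : R4) (hf : DifferentiableAt ℝ f x)
    (hg : DifferentiableAt ℝ g x) :
    pdR m (fun y => f y + g y) x = pdR m f x + pdR m g x := by
  unfold pdR
  rw [(hf.hasFDerivAt.fun_add hg.hasFDerivAt).fderiv]
  simp

lemma pdR_sub' {f g : R4 → ℝ} (m : Fin 4) (x : R4) (hf : DifferentiableAt ℝ f x)
    (hg : DifferentiableAt ℝ g x) :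
    pdR m (fun y => f y - g y) x = pdR m f x - pdR m g x := by
  unfold pdR
  rw [(hf.hasFDerivAt.fun_sub hg.hasFDerivAt).fderiv]
  simp

lemma pdR_mul' {f g : R4 → ℝ} (m : Fin 4) (x : R4) (hf : DifferentiableAt ℝ f x)
    (hg : DifferentiableAt ℝ g x) :
    pdR m (fun y => f y * g y) x = pdR m f x * g x + f x * pdR m g x := by
  unfold pdR
  rw [(hf.hasFDerivAt.fun_mul hg.hasFDerivAt).fderiv]
  simp
  ring

lemma pdR_const' (m : Fin 4) (x : R4) (c : ℝ) : pdR m (fun _ => c) x = 0 := by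
  unfold pdR
  simp

lemma pdR_div' {f g : R4 → ℝ} (m : Fin 4) (x : R4) (hf : DifferentiableAt ℝ f x)
    (hg : DifferentiableAt ℝ g x) (h0 : g x ≠ 0) :
    pdR m (fun y => f y / g y) x = (pdR m f x - f x / g x * pdR m g x) / g x := by
  unfold pdR
  have hi := (hasDerivAt_inv h0).comp_hasFDerivAt x hg.hasFDerivAt
  have h := (hf.hasFDerivAt.fun_mul hi).fderiv
  simp only [div_eq_mul_inv]
  simp only [Function.comp_def] at h
  rw [h]
  simp
  field_simp
  ring

lemma pdR_smooth {f : R4 → ℝ} (hf : ContDiff ℝ (⊤ : ℕ∞) f) (m : Fin 4) :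
    ContDiff ℝ (⊤ : ℕ∞) (fun y => pdR m f y) := by
  unfold pdR
  exact (hf.fderiv_right (m := (⊤ : ℕ∞)) (by simp)).clm_apply contDiff_const

lemma pdR_symm {f : R4 → ℝ} (hf : ContDiff ℝ (⊤ : ℕ∞) f) (m n : Fin 4) (x : R4) :
    pdR m (fun y => pdR n f y) x = pdR n (fun y => pdR m f y) x := by
  have hd : DifferentiableAt ℝ (fderiv ℝ f) x :=
    ((hf.fderiv_right (m := (⊤ : ℕ∞)) (by simp)).differentiable (by simp)) x
  have hs : IsSymmSndFDerivAt ℝ f x := hf.contDiffAt.isSymmSndFDerivAt (by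
    simp only [minSmoothness_of_isRCLikeNormedField]; exact WithTop.coe_le_coe.2 (le_top : (2 : ℕ∞) ≤ ⊤))
  have key : ∀ a b : Fin 4, pdR a (fun y => pdR b f y) x
      = fderiv ℝ (fderiv ℝ f) x (Pi.single a 1) (Pi.single b 1) := by
    intro a b
    unfold pdR
    rw [(hd.hasFDerivAt.clm_apply (hasFDerivAt_const (Pi.single b (1:ℝ)) x)).fderiv]
    simp
  rw [key, key]
  exact hs _ _

lemma pdC_eq {f : R4 → ℂ} (m : Fin 4) (x : R4) (hf : DifferentiableAt ℝ f x) :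
    pdC m f x = (pdR m (fun y => (f y).re) x : ℂ) + (pdR m (fun y => (f y).im) x : ℂ) * Complex.I := by
  have h1 := (Complex.reCLM.hasFDerivAt.comp x hf.hasFDerivAt).fderiv
  have h2 := (Complex.imCLM.hasFDerivAt.comp x hf.hasFDerivAt).fderiv
  unfold pdR pdC
  rw [show (fun y => (f y).re) = Complex.reCLM ∘ f from rfl,
    show (fun y => (f y).im) = Complex.imCLM ∘ f from rfl, h1, h2]
  simp [Complex.re_add_im]

lemma triple_alg (ρ a b c ρm am bm cm ρn an bn cn : ℝ) (h : ρ ≠ 0) :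
    (a/ρ) * (((bm - b/ρ*ρm)/ρ) * ((cn - c/ρ*ρn)/ρ) - ((cm - c/ρ*ρm)/ρ) * ((bn - b/ρ*ρn)/ρ))
    + (b/ρ) * (((cm - c/ρ*ρm)/ρ) * ((an - a/ρ*ρn)/ρ) - ((am - a/ρ*ρm)/ρ) * ((cn - c/ρ*ρn)/ρ))
    + (c/ρ) * (((am - a/ρ*ρm)/ρ) * ((bn - b/ρ*ρn)/ρ) - ((bm - b/ρ*ρm)/ρ) * ((an - a/ρ*ρn)/ρ))
    = (a * (bm*cn - cm*bn) + b * (cm*an - am*cn) + c * (am*bn - bm*an)) / ρ^3 := by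
  field_simp
  ring

section
variable (p q r s : R4 → ℝ)

def rh (y : R4) : ℝ := (1/2) * (p y * p y + q y * q y + r y * r y + s y * s y)
def j1 (y : R4) : ℝ := p y * r y + q y * s y
def j2 (y : R4) : ℝ := p y * s y - q y * r y
def j3 (y : R4) : ℝ := (1/2) * (p y * p y + q y * q y - r y * r y - s y * s y)
def aa (n : Fin 4) (y : R4) : ℝ :=
  (-(1/2)) * (p y * pdR n q y - q y * pdR n p y + r y * pdR n s y - s y * pdR n r y)

lemma curl_core (hp : ContDiff ℝ (⊤ : ℕ∞) p) (hq : ContDiff ℝ (⊤ : ℕ∞) q)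
    (hr : ContDiff ℝ (⊤ : ℕ∞) r) (hs : ContDiff ℝ (⊤ : ℕ∞) s) (x : R4)
    (h0 : rh p q r s x ≠ 0) (m n : Fin 4) (V : Fin 3 → Fin 4 → ℝ)
    (hV0 : ∀ m, V 0 m = pdR m (fun y => j1 p q r s y / rh p q r s y) x)
    (hV1 : ∀ m, V 1 m = pdR m (fun y => j2 p q r s y / rh p q r s y) x)
    (hV2 : ∀ m, V 2 m = pdR m (fun y => j3 p q r s y / rh p q r s y) x) :
    pdR m (fun y => aa p q r s n y / rh p q r s y) x
      - pdR n (fun y => aa p q r s m y / rh p q r s y) x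
      + (1/2) * ((j1 p q r s x / rh p q r s x) * (V 1 m * V 2 n - V 2 m * V 1 n)
        + (j2 p q r s x / rh p q r s x) * (V 2 m * V 0 n - V 0 m * V 2 n)
        + (j3 p q r s x / rh p q r s x) * (V 0 m * V 1 n - V 1 m * V 0 n)) = 0 := by
  have dp := hp.differentiable (by simp)
  have dq := hq.differentiable (by simp)
  have dr := hr.differentiable (by simp)
  have ds := hs.differentiable (by simp)
  have dp' := fun m => (pdR_smooth hp m).differentiable (by simp)
  have dq' := fun m => (pdR_smooth hq m).differentiable (by simp)
  have dr' := fun m => (pdR_smooth hr m).differentiable (by simp)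
  have ds' := fun m => (pdR_smooth hs m).differentiable (by simp)
  have drh : Differentiable ℝ (rh p q r s) := by unfold rh; fun_prop
  have dj1 : Differentiable ℝ (j1 p q r s) := by unfold j1; fun_prop
  have dj2 : Differentiable ℝ (j2 p q r s) := by unfold j2; fun_prop
  have dj3 : Differentiable ℝ (j3 p q r s) := by unfold j3; fun_prop
  have daa : ∀ n, Differentiable ℝ (aa p q r s n) := by intro n; unfold aa; fun_prop
  have erh : ∀ m, pdR m (rh p q r s) x
      = p x * pdR m p x + q x * pdR m q x + r x * pdR m r x + s x * pdR m s x := by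
    intro m
    unfold rh
    rw [pdR_mul' _ _ (by fun_prop) (by fun_prop), pdR_add' _ _ (by fun_prop) (by fun_prop),
      pdR_add' _ _ (by fun_prop) (by fun_prop), pdR_add' _ _ (by fun_prop) (by fun_prop),
      pdR_mul' _ _ (by fun_prop) (by fun_prop), pdR_mul' _ _ (by fun_prop) (by fun_prop),
      pdR_mul' _ _ (by fun_prop) (by fun_prop), pdR_mul' _ _ (by fun_prop) (by fun_prop),
      pdR_const']
    ring
  have ej3 : ∀ m, pdR m (j3 p q r s) x
      = p x * pdR m p x + q x * pdR m q x - r x * pdR m r x - s x * pdR m s x := by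
    intro m
    unfold j3
    rw [pdR_mul' _ _ (by fun_prop) (by fun_prop), pdR_sub' _ _ (by fun_prop) (by fun_prop),
      pdR_sub' _ _ (by fun_prop) (by fun_prop), pdR_add' _ _ (by fun_prop) (by fun_prop),
      pdR_mul' _ _ (by fun_prop) (by fun_prop), pdR_mul' _ _ (by fun_prop) (by fun_prop),
      pdR_mul' _ _ (by fun_prop) (by fun_prop), pdR_mul' _ _ (by fun_prop) (by fun_prop),
      pdR_const']
    ring
  have ej1 : ∀ m, pdR m (j1 p q r s) x
      = pdR m p x * r x + p x * pdR m r x + (pdR m q x * s x + q x * pdR m s x) := by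
    intro m
    unfold j1
    rw [pdR_add' _ _ (by fun_prop) (by fun_prop),
      pdR_mul' _ _ (by fun_prop) (by fun_prop), pdR_mul' _ _ (by fun_prop) (by fun_prop)]
  have ej2 : ∀ m, pdR m (j2 p q r s) x
      = pdR m p x * s x + p x * pdR m s x - (pdR m q x * r x + q x * pdR m r x) := by
    intro m
    unfold j2
    rw [pdR_sub' _ _ (by fun_prop) (by fun_prop),
      pdR_mul' _ _ (by fun_prop) (by fun_prop), pdR_mul' _ _ (by fun_prop) (by fun_prop)]
  have eaa : ∀ m n, pdR m (aa p q r s n) x = (-(1/2)) *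
      ((pdR m p x * pdR n q x + p x * pdR m (fun y => pdR n q y) x)
      - (pdR m q x * pdR n p x + q x * pdR m (fun y => pdR n p y) x)
      + (pdR m r x * pdR n s x + r x * pdR m (fun y => pdR n s y) x)
      - (pdR m s x * pdR n r x + s x * pdR m (fun y => pdR n r y) x)) := by
    intro m n
    have := dp' n; have := dq' n; have := dr' n; have := ds' n
    unfold aa
    rw [pdR_mul' _ _ (by fun_prop) (by fun_prop), pdR_sub' _ _ (by fun_prop) (by fun_prop),
      pdR_add' _ _ (by fun_prop) (by fun_prop), pdR_sub' _ _ (by fun_prop) (by fun_prop),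
      pdR_mul' _ _ (by fun_prop) (by fun_prop), pdR_mul' _ _ (by fun_prop) (by fun_prop),
      pdR_mul' _ _ (by fun_prop) (by fun_prop), pdR_mul' _ _ (by fun_prop) (by fun_prop),
      pdR_const']
    ring
  simp only [hV0, hV1, hV2]
  simp only [fun m => pdR_div' m x (dj1 x) (drh x) h0, fun m => pdR_div' m x (dj2 x) (drh x) h0,
    fun m => pdR_div' m x (dj3 x) (drh x) h0, fun m n => pdR_div' m x (daa n x) (drh x) h0]
  rw [triple_alg _ _ _ _ _ _ _ _ _ _ _ _ h0]
  have hpoly : 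
    (pdR m (aa p q r s n) x - pdR n (aa p q r s m) x) * rh p q r s x ^ 2
     - (aa p q r s n x * pdR m (rh p q r s) x - aa p q r s m x * pdR n (rh p q r s) x) * rh p q r s x
     + (1/2) * (j1 p q r s x * (pdR m (j2 p q r s) x * pdR n (j3 p q r s) x - pdR m (j3 p q r s) x * pdR n (j2 p q r s) x)
      + j2 p q r s x * (pdR m (j3 p q r s) x * pdR n (j1 p q r s) x - pdR m (j1 p q r s) x * pdR n (j3 p q r s) x)
      + j3 p q r s x * (pdR m (j1 p q r s) x * pdR n (j2 p q r s) x - pdR m (j2 p q r s) x * pdR n (j1 p q r s) x)) = 0 := by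
    rw [eaa, eaa, erh, erh, ej1, ej1, ej2, ej2, ej3, ej3, pdR_symm hp m n, pdR_symm hq m n,
      pdR_symm hr m n, pdR_symm hs m n]
    unfold aa rh j1 j2 j3
    ring
  generalize rh p q r s x = R at *
  field_simp
  linear_combination 2 * hpoly

end

/-- Quantization condition for the right-spinor Dirac equation, with momentum components
`u_n = T_n^0 / ρ`. -/
theorem quantization_condition
    (Γ : Fin 4 → R4 → ℝ) (hΓ : ∀ μ, ContDiff ℝ (⊤ : ℕ∞) (Γ μ))
    (φ : R4 → M2) (hφ : ∀ i j, ContDiff ℝ (⊤ : ℕ∞) (fun x => φ x i j))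
    (hDirac : ∀ x : R4,
      (∑ μ : Fin 4, edual μ * pdM μ (fun y => gradeAut (φ y) * P) x)
        + Complex.I • ((∑ μ : Fin 4, (Γ μ x : ℂ) • edual μ) * (gradeAut (φ x) * P)) = 0)
    (hj : ∀ x : R4, jR φ 0 x ≠ 0) :
    ∀ x : R4, ∀ i : Fin 3,
      ∑ m : Fin 3, ∑ n : Fin 3,
        eps i m n *
          (pdR m.succ (fun y => TR Γ φ n.succ 0 y / jR φ 0 y - Γ n.succ y) x
            + (1/4) * ∑ k : Fin 3,
                vR φ k x *
                  cross3 (fun a => pdR m.succ (fun y => vR φ a y) x)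
                         (fun b => pdR n.succ (fun y => vR φ b y) x) k) = 0 := by
  intro x i
  have hC : ∀ i j, Differentiable ℝ (fun x => φ x i j) := fun i j => (hφ i j).differentiable (by simp)
  have hre : ∀ i j, ContDiff ℝ (⊤ : ℕ∞) (fun x => (φ x i j).re) := fun i j =>
    Complex.reCLM.contDiff.comp (hφ i j)
  have him : ∀ i j, ContDiff ℝ (⊤ : ℕ∞) (fun x => (φ x i j).im) := fun i j =>
    Complex.imCLM.contDiff.comp (hφ i j)
  set p : R4 → ℝ := fun x => (φ x 0 1).re with hp
  set q : R4 → ℝ := fun x => (φ x 0 1).im with hq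
  set r : R4 → ℝ := fun x => (φ x 1 1).re with hr
  set s : R4 → ℝ := fun x => (φ x 1 1).im with hs
  have e0 : ∀ y, jR φ 0 y = rh p q r s y := by
    intro y
    simp [jR, jComp, e, Pbar, Matrix.trace_fin_two, Matrix.mul_apply, Fin.sum_univ_two, rh, hp, hq, hr, hs]
    ring
  have e1 : ∀ y, jR φ 1 y = j1 p q r s y := by
    intro y
    simp [jR, jComp, e, Pbar, Matrix.trace_fin_two, Matrix.mul_apply, Fin.sum_univ_two, j1, hp, hq, hr, hs]
    ring
  have e2 : ∀ y, jR φ 2 y = j2 p q r s y := by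
    intro y
    simp [jR, jComp, e, Pbar, Matrix.trace_fin_two, Matrix.mul_apply, Fin.sum_univ_two, j2, hp, hq, hr, hs]
    ring
  have e3 : ∀ y, jR φ 3 y = j3 p q r s y := by
    intro y
    simp [jR, jComp, e, Pbar, Matrix.trace_fin_two, Matrix.mul_apply, Fin.sum_univ_two, j3, hp, hq, hr, hs]
    ring
  have h0 : ∀ y, rh p q r s y ≠ 0 := fun y => e0 y ▸ hj y
  have hneg : ∀ (m : Fin 4) (f : R4 → ℝ) (y : R4), pdR m (fun y => - f y) y = - pdR m f y := by
    intro m f y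
    unfold pdR
    simp [fderiv_fun_neg]
  have eT : ∀ n y, TR Γ φ n 0 y / jR φ 0 y - Γ n y = aa p q r s n y / rh p q r s y := by
    intro n y
    have hT : TR Γ φ n 0 y = aa p q r s n y + Γ n y * rh p q r s y := by
      have c1 : pdC n (fun y => (starRingEnd ℂ) (φ y 1 1)) y = pdR n r y - pdR n s y * Complex.I := by
        rw [pdC_eq _ _ (by have := hC 1 1; fun_prop)]
        simp only [Complex.conj_re, Complex.conj_im, hneg, hr, hs]
        push_cast; ring
      have c2 : pdC n (fun y => -(starRingEnd ℂ) (φ y 0 1)) y = -pdR n p y + pdR n q y * Complex.I := by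
        rw [pdC_eq _ _ (by have := hC 0 1; fun_prop)]
        simp only [Complex.conj_re, Complex.conj_im, Complex.neg_re, Complex.neg_im, hneg, hp, hq, neg_neg]
        push_cast; ring
      have c3 : pdC n (fun y => φ y 1 1) y = pdR n r y + pdR n s y * Complex.I := 
        pdC_eq _ _ (hC 1 1 y)
      have c4 : pdC n (fun y => - φ y 0 1) y = -pdR n p y - pdR n q y * Complex.I := by
        rw [pdC_eq _ _ (by have := hC 0 1; fun_prop)]
        simp only [Complex.neg_re, Complex.neg_im, hneg, hp, hq]
        push_cast; ring
      rw [← e0]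
      unfold TR TComp
      rw [Complex.add_re, Complex.re_ofReal_mul]
      congr 1
      simp [edual, P, gradeAut, pdM, Matrix.adjugate_fin_two, Matrix.trace_fin_two, Matrix.mul_apply, Fin.sum_univ_two, c1, c2, c3, c4, aa]
      simp only [hp, hq, hr, hs]
      ring
    rw [hT, e0]
    have := h0 y
    field_simp
    ring
  have v0 : ∀ y, vR φ 0 y = j1 p q r s y / rh p q r s y := by
    intro y; rw [← e0, ← e1]; rfl
  have v1 : ∀ y, vR φ 1 y = j2 p q r s y / rh p q r s y := by
    intro y; rw [← e0, ← e2]; rfl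
  have v2 : ∀ y, vR φ 2 y = j3 p q r s y / rh p q r s y := by
    intro y; rw [← e0, ← e3]; rfl
  have key := fun m n => curl_core p q r s (hre 0 1) (him 0 1) (hre 1 1) (him 1 1) x (h0 x) m n
    (fun k m => pdR m (fun y => vR φ k y) x) 
    (by intro m; simp only [v0]) (by intro m; simp only [v1]) (by intro m; simp only [v2])
  simp only [eT]
  simp only [← v0, ← v1, ← v2] at key
  have k01 := key (Fin.succ 0) (Fin.succ 1)
  have k12 := key (Fin.succ 1) (Fin.succ 2)
  have k20 := key (Fin.succ 2) (Fin.succ 0)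
  fin_cases i
  · simp only [Fin.sum_univ_three, cross3, eps]
    simp (config := {decide := true}) only [if_true, if_false]
    linear_combination k12
  · simp only [Fin.sum_univ_three, cross3, eps]
    simp (config := {decide := true}) only [if_true, if_false]
    linear_combination k20
  · simp only [Fin.sum_univ_three, cross3, eps]
    simp (config := {decide := true}) only [if_true, if_false]
    linear_combination k01
end
end

section
/- Form invariance of the Dirac derivative term: let M ∈ M₂(ℂ) be invertible and ψ : ℝ⁴ → M₂(ℂ) smooth. Define y : ℝ⁴ → ℝ⁴ by y(x)^κ := (M·x̃·M†)^κ for κ = 0,…,3, where x̃ := Σ_{μ=0}^{3} x^μ·e_μ (these components are real since x̃ is Hermitian), and define φ(x) := M⁻¹·ψ(y(x)). Then for every x ∈ ℝ⁴: adj(φ(x))·( Σ_{μ=0}^{3} e^μ·∂_μφ̂(x) ) = adj(ψ(y(x)))·( Σ_{κ=0}^{3} e^κ·(∂_κψ̂)(y(x)) ). -/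
open Matrix

noncomputable section

/-- The spacetime point `x` as a Hermitian paravector `x̃ = Σ x^μ e_μ`. -/
def paravec (x : R4) : M2 := ∑ μ : Fin 4, (x μ : ℂ) • e μ

theorem adj_e (κ : Fin 4) : (e κ).adjugate = edual κ := by
  fin_cases κ <;> ext i j <;> fin_cases i <;> fin_cases j <;>
    simp [e, edual, Matrix.adjugate_fin_two]

theorem herm_e (κ : Fin 4) : (e κ)ᴴ = e κ := by
  fin_cases κ <;> ext i j <;> fin_cases i <;> fin_cases j <;>
    simp [e, Matrix.conjTranspose_apply]

theorem sum_dual (h : M2) (hh : hᴴ = h) :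
    ∑ μ : Fin 4, ((((1/2 : ℂ) * (h * e μ).trace).re : ℝ) : ℂ) • edual μ = h.adjugate := by
  have h00 := congrArg Complex.im (congrFun (congrFun hh 0) 0)
  have h11 := congrArg Complex.im (congrFun (congrFun hh 1) 1)
  have h01r := congrArg Complex.re (congrFun (congrFun hh 0) 1)
  have h01i := congrArg Complex.im (congrFun (congrFun hh 0) 1)
  simp [Matrix.conjTranspose_apply] at h00 h11 h01r h01i
  ext i j
  fin_cases i <;> fin_cases j <;> apply Complex.ext <;>
    simp [Fin.sum_univ_four, e, edual, Matrix.adjugate_fin_two, Matrix.trace_fin_two,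
      Matrix.mul_apply, Fin.sum_univ_two] <;> linarith

/-- The matrix of the linear map `y`. -/
def Lmat (M : M2) : Matrix (Fin 4) (Fin 4) ℝ :=
  Matrix.of fun κ μ => ((1/2 : ℂ) * (M * e μ * Mᴴ * e κ).trace).re

theorem y_lin (M : M2) (x : R4) (κ : Fin 4) :
    ((1/2 : ℂ) * (M * paravec x * Mᴴ * e κ).trace).re = (Lmat M *ᵥ x) κ := by
  simp only [paravec, Lmat, Matrix.mulVec, dotProduct, Matrix.of_apply, Finset.mul_sum,
    Finset.sum_mul, Matrix.trace_sum, Complex.re_sum, Matrix.mul_smul, Matrix.smul_mul,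
    Matrix.trace_smul, smul_eq_mul]
  refine Finset.sum_congr rfl fun μ _ => ?_
  rw [mul_left_comm, Complex.re_ofReal_mul, mul_comm]

theorem key (M N : M2) (hN : Nᴴ * M.adjugate = 1) (κ : Fin 4) :
    Nᴴ * (∑ μ : Fin 4, (Lmat M κ μ : ℂ) • edual μ) * N = edual κ := by
  have h1 : ∀ μ, Lmat M κ μ = ((1/2 : ℂ) * ((Mᴴ * e κ * M) * e μ).trace).re := by
    intro μ
    simp only [Lmat, Matrix.of_apply]
    rw [show M * e μ * Mᴴ * e κ = (M * e μ) * (Mᴴ * e κ) by simp only [Matrix.mul_assoc],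
      Matrix.trace_mul_comm]
    simp only [Matrix.mul_assoc]
  simp only [h1]
  rw [sum_dual _ (by simp [Matrix.conjTranspose_mul, herm_e, Matrix.mul_assoc]),
    Matrix.adjugate_mul_distrib, Matrix.adjugate_mul_distrib, adj_e]
  have h2 : Mᴴ.adjugate * N = 1 := by
    have := congrArg Matrix.conjTranspose hN
    simpa [Matrix.conjTranspose_mul, Matrix.adjugate_conjTranspose] using this
  calc _ = (Nᴴ * M.adjugate) * edual κ * (Mᴴ.adjugate * N) := by simp only [Matrix.mul_assoc]
    _ = _ := by rw [hN, h2]; simp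

theorem diff_gradeAut (ψ : R4 → M2) (hψ : ∀ i j, ContDiff ℝ (⊤ : ℕ∞) (fun x => ψ x i j))
    (i j : Fin 2) : Differentiable ℝ (fun x => gradeAut (ψ x) i j) := by
  have hd : ∀ i j, Differentiable ℝ (fun x => ψ x i j) :=
    fun i j => (hψ i j).differentiable (by simp)
  have hs : ∀ i j, Differentiable ℝ (fun x => star (ψ x i j)) := fun i j => (hd i j).star
  fin_cases i <;> fin_cases j <;>
    simp [gradeAut, Matrix.adjugate_fin_two, Matrix.conjTranspose_apply] <;>
    exact hs _ _

theorem pdM_comp (A : Matrix (Fin 4) (Fin 4) ℝ) (N : M2) (f : R4 → M2)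
    (hf : ∀ i j, Differentiable ℝ (fun x => f x i j)) (μ : Fin 4) (x : R4) :
    pdM μ (fun z => N * f (A *ᵥ z)) x = N * ∑ κ : Fin 4, (A κ μ : ℂ) • pdM κ f (A *ᵥ x) := by
  have hA : HasFDerivAt (fun z : R4 => A *ᵥ z) (LinearMap.toContinuousLinearMap A.mulVecLin) x :=
    (LinearMap.toContinuousLinearMap A.mulVecLin).hasFDerivAt
  have hs : A *ᵥ (Pi.single μ 1) = ∑ κ, A κ μ • (Pi.single κ 1 : R4) := by
    ext k
    simp [Finset.sum_apply, Pi.single_apply]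
  ext i j
  have h : HasFDerivAt (fun z => (N * f (A *ᵥ z)) i j)
      (∑ k, N i k • ((fderiv ℝ (fun x => f x k j) (A *ᵥ x)).comp
        (LinearMap.toContinuousLinearMap A.mulVecLin))) x := by
    simp only [Matrix.mul_apply]
    refine HasFDerivAt.fun_sum fun k _ => ?_
    exact (((hf k j) (A *ᵥ x)).hasFDerivAt.comp x hA).const_mul (N i k)
  have h0 : pdM μ (fun z => N * f (A *ᵥ z)) x i j
      = fderiv ℝ (fun z => (N * f (A *ᵥ z)) i j) x (Pi.single μ 1) := rfl
  rw [h0, h.fderiv]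
  simp only [pdM, Matrix.of_apply, pdC, Matrix.mul_apply, Matrix.sum_apply,
    Matrix.smul_apply]
  simp only [_root_.sum_apply, _root_.smul_apply,
    ContinuousLinearMap.comp_apply, LinearMap.coe_toContinuousLinearMap', Matrix.mulVecLin_apply,
    hs, map_sum, map_smul, smul_eq_mul, Complex.real_smul]

/-- Form invariance of the derivative term of the Dirac equation under the
transformations `x ↦ M·x̃·M†`, `φ(x) = M⁻¹·ψ(y(x))`. -/
theorem dirac_derivative_form_invariance
    (M : M2) (hM : M.det ≠ 0)
    (ψ : R4 → M2) (hψ : ∀ i j, ContDiff ℝ (⊤ : ℕ∞) (fun x => ψ x i j))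
    (y : R4 → R4)
    (hy : ∀ x, ∀ κ : Fin 4,
      y x κ = ((1/2 : ℂ) * (M * paravec x * Mᴴ * e κ).trace).re)
    (φ : R4 → M2) (hφ : ∀ x, φ x = M⁻¹ * ψ (y x)) :
    ∀ x : R4,
      (φ x).adjugate * (∑ μ : Fin 4, edual μ * pdM μ (fun z => gradeAut (φ z)) x)
        = (ψ (y x)).adjugate *
            (∑ κ : Fin 4, edual κ * pdM κ (fun z => gradeAut (ψ z)) (y x)) := by
  intro x
  have hy' : y = fun x => Lmat M *ᵥ x := by
    ext x κ
    rw [hy, y_lin]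
  set N : M2 := gradeAut M⁻¹ with hNdef
  have hNH : Nᴴ = (M⁻¹).adjugate := by simp [hNdef, gradeAut]
  have hN : Nᴴ * M.adjugate = 1 := by
    rw [hNH, ← Matrix.adjugate_mul_distrib, Matrix.mul_nonsing_inv _ (isUnit_iff_ne_zero.mpr hM),
      Matrix.adjugate_one]
  have hg : (fun z => gradeAut (φ z)) = fun z => N * gradeAut (ψ (Lmat M *ᵥ z)) := by
    ext1 z
    rw [hφ, hy']
    simp [gradeAut, hNdef, Matrix.adjugate_mul_distrib, Matrix.conjTranspose_mul]
  have hp := fun μ => pdM_comp (Lmat M) N (fun z => gradeAut (ψ z)) (diff_gradeAut ψ hψ) μ x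
  rw [hg]
  simp only [hp]
  simp only [hφ, Matrix.adjugate_mul_distrib, ← hNH, hy']
  rw [Matrix.mul_assoc]
  congr 1
  simp only [Finset.mul_sum]
  rw [Finset.sum_comm]
  refine Finset.sum_congr rfl fun κ _ => ?_
  conv_rhs => rw [← key M N hN κ]
  simp only [Finset.mul_sum, Finset.sum_mul, Matrix.mul_assoc, Matrix.mul_smul, Matrix.smul_mul]
end
end

section
/- Equivalence of the classical Dirac equation in the Weyl basis with its Cl(3) form: let q, m ∈ ℝ, A₀,A₁,A₂,A₃ : ℝ⁴ → ℝ smooth, A := Σ_μ A_μ·e^μ, and let ξ, η : ℝ⁴ → ℂ² be smooth. Define φ : ℝ⁴ → M₂(ℂ) by φ := !![ξ₁, -conj(η₂); ξ₂, conj(η₁)]. Then the pair (ξ, η) satisfies the chirally split Dirac system Σ_{μ=0}^{3} e^μ·(∂_μη + i·q·A_μ·η) + i·m·ξ = 0 and Σ_{μ=0}^{3} ê^μ·(∂_μξ + i·q·A_μ·ξ) + i·m·η = 0 on ℝ⁴ (where ê⁰ := 1 and êᵏ := e_k, with the matrices acting on ℂ²) if and only if φ satisfies the Cl(3) Dirac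 equation Σ_{μ=0}^{3} e^μ·∂_μφ̂ + i·q·A·φ̂·e₃ + i·m·φ·e₃ = 0 on ℝ⁴. -/
open Matrix

noncomputable section

/-- Partial derivative `∂_μ` of a `ℂ²`-valued function on `ℝ⁴`. -/
def pdV (μ : Fin 4) (f : R4 → Fin 2 → ℂ) (x : R4) : Fin 2 → ℂ :=
  fun i => fderiv ℝ (fun y => f y i) x (Pi.single μ 1)

/-- The matrices `ê⁰ := 1` and `êᵏ := e k`. -/
def ehat : Fin 4 → M2 := ![1, e 1, e 2, e 3]

theorem pdC_conj_aux (μ : Fin 4) (f : R4 → ℂ) (x : R4) :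
    fderiv ℝ (fun y => (starRingEnd ℂ) (f y)) x (Pi.single μ 1)
      = (starRingEnd ℂ) (fderiv ℝ f x (Pi.single μ 1)) := by
  have h := Complex.conjCLE.comp_fderiv (f := f) (x := x)
  have h2 : (fun y => (starRingEnd ℂ) (f y)) = (Complex.conjCLE ∘ f) := by
    funext y; simp
  rw [h2, h]
  simp

theorem gradeAut_aux (a b c d : ℂ) :
    gradeAut !![a, -(starRingEnd ℂ) d; b, (starRingEnd ℂ) c]
      = !![c, -(starRingEnd ℂ) b; d, (starRingEnd ℂ) a] := by
  unfold gradeAut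
  rw [Matrix.adjugate_fin_two_of]
  ext i j
  fin_cases i <;> fin_cases j <;> simp [Matrix.conjTranspose_apply]

theorem pdM_aux (ξ η : R4 → Fin 2 → ℂ) (μ : Fin 4) (x : R4) :
    pdM μ (fun z => !![η z 0, -(starRingEnd ℂ) (ξ z 1); η z 1, (starRingEnd ℂ) (ξ z 0)]) x
      = !![pdV μ η x 0, -(starRingEnd ℂ) (pdV μ ξ x 1);
           pdV μ η x 1, (starRingEnd ℂ) (pdV μ ξ x 0)] := by
  ext i j
  fin_cases i <;> fin_cases j <;> simp [pdM, pdC, pdV, pdC_conj_aux, fderiv_fun_neg]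

/-- Equivalence of the classical Dirac equation in the Weyl basis (chirally split
form for `(ξ, η)`) with its `Cl(3)` formulation for `φ = !![ξ₁, -η₂*; ξ₂, η₁*]`. -/
theorem weyl_dirac_equiv_cl3
    (q m : ℝ) (A : Fin 4 → R4 → ℝ) (hA : ∀ μ, ContDiff ℝ (⊤ : ℕ∞) (A μ))
    (ξ η : R4 → Fin 2 → ℂ)
    (hξ : ∀ i, ContDiff ℝ (⊤ : ℕ∞) (fun x => ξ x i)) (hη : ∀ i, ContDiff ℝ (⊤ : ℕ∞) (fun x => η x i))
    (φ : R4 → M2)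
    (hφ : ∀ x, φ x = !![ξ x 0, -(starRingEnd ℂ) (η x 1);
                        ξ x 1, (starRingEnd ℂ) (η x 0)]) :
    (∀ x : R4,
        (∑ μ : Fin 4, (edual μ) *ᵥ
            (pdV μ η x + ((Complex.I * q * A μ x : ℂ)) • η x))
          + ((Complex.I * m : ℂ)) • ξ x = 0 ∧
        (∑ μ : Fin 4, (ehat μ) *ᵥ
            (pdV μ ξ x + ((Complex.I * q * A μ x : ℂ)) • ξ x))
          + ((Complex.I * m : ℂ)) • η x = 0)
      ↔
    (∀ x : R4,
        (∑ μ : Fin 4, edual μ * pdM μ (fun z => gradeAut (φ z)) x)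
          + (Complex.I * q : ℂ) •
              ((∑ μ : Fin 4, (A μ x : ℂ) • edual μ) * gradeAut (φ x) * e 3)
          + (Complex.I * m : ℂ) • (φ x * e 3) = 0) := by
  refine forall_congr' fun x => ?_
  have hg : ∀ z, gradeAut (φ z)
      = !![η z 0, -(starRingEnd ℂ) (ξ z 1); η z 1, (starRingEnd ℂ) (ξ z 0)] := fun z => by
    rw [hφ z, gradeAut_aux]
  simp only [hg, pdM_aux]
  rw [hφ x]
  generalize pdV = D
  have key : ∀ a b c d c' d' : ℂ, c' = -(starRingEnd ℂ) d → d' = (starRingEnd ℂ) c →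
      (((a = 0 ∧ b = 0) ∧ (c = 0 ∧ d = 0)) ↔ ((a = 0 ∧ c' = 0) ∧ (b = 0 ∧ d' = 0))) := by
    rintro a b c d _ _ rfl rfl
    simp only [neg_eq_zero, map_eq_zero]
    tauto
  rw [← Matrix.ext_iff, funext_iff, funext_iff]
  simp only [Fin.forall_fin_two]
  have split : ∀ a b c d a' b' c' d' : ℂ, a' = a → b' = b → c' = -(starRingEnd ℂ) d →
      d' = (starRingEnd ℂ) c →
      (((a = 0 ∧ b = 0) ∧ (c = 0 ∧ d = 0)) ↔ ((a' = 0 ∧ c' = 0) ∧ (b' = 0 ∧ d' = 0))) := by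
    rintro a b c d _ _ _ _ rfl rfl h1 h2
    exact key _ _ _ _ _ _ h1 h2
  apply split <;>
  · simp [Fin.sum_univ_four, edual, ehat, e, Matrix.mul_apply, Matrix.mulVec, dotProduct,
      Fin.sum_univ_two, Matrix.add_apply, Matrix.smul_apply, Matrix.one_apply]
    ring
end
end
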